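/- Let n be a positive integer and let x be a complex number which is not an integer. Then Σ_{k=0}^{n} (−1)^k C(n,k) · C(n+k,k)/C(x+k,k) · k · H_k^{⟨2⟩}(x) = (−1)^n · (n(n+1)/(2(1−x))) · (C(−x+n,n)/C(x+n,n)) · { H_n^{⟨2⟩}(x) − H_n^{⟨2⟩}(−x) + [H_n(x) − H_n(−x)] · [H_n(x) − H_n(−x) − 2H_{n+1}((x−n−2)/2) − 2(x² − n − n²)/(x n (n+1))] + H_n((x−n)/2) · [H_{n+1}((x−n−2)/2) + 2(x³ − n x² + n² + n³)/(x(x−n) n (n+1))] + 4(x² − n x + n + n²)/(x (x−n)² (n+1)) }. -/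

import Mathlib

open Finset

/-- Generalized harmonic number `H_n(x) = ∑_{k=1}^n 1/(x+k)`. -/
noncomputable def genH (n : ℕ) (x : ℂ) : ℂ := ∑ k ∈ Finset.range n, 1 / (x + (k + 1))

/-- Generalized second-order harmonic number `H_n^{⟨2⟩}(x) = ∑_{k=1}^n 1/(x+k)^2`. -/
noncomputable def genH2 (n : ℕ) (x : ℂ) : ℂ := ∑ k ∈ Finset.range n, 1 / (x + (k + 1)) ^ 2

/-- Generalized binomial coefficient `C(z,m) = (∏_{j=0}^{m-1} (z-j))/m!`. -/
noncomputable def cbinom (z : ℂ) (m : ℕ) : ℂ := (∏ j ∈ Finset.range m, (z - j)) / (m.factorial : ℂ)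

/-- The summand `(-1)^k C(n,k) C(n+k,k) / C(x+k,k)`. -/
noncomputable def legendreTerm (x : ℂ) (n k : ℕ) : ℂ :=
  (-1 : ℂ) ^ k * (n.choose k : ℂ) * (((n + k).choose k : ℂ) / cbinom (x + k) k)

/-- The product `∏_{i=1}^n (x-i)/(x+i)`, written with binomial coefficients. -/
noncomputable def reflectionRatio (x : ℂ) (n : ℕ) : ℂ :=
  (-1 : ℂ) ^ n * (cbinom (-x + n) n / cbinom (x + n) n)

/-- The alternating sum `∑_{j=-n}^n (-1)^(n-j)/(x+j)`, written with harmonic numbers. -/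
noncomputable def altH (x : ℂ) (n : ℕ) : ℂ :=
  genH (n + 1) ((x - n - 2) / 2) - (genH n x - genH n (-x)) - 1 / x

lemma genH_succ (n : ℕ) (x : ℂ) : genH (n + 1) x = genH n x + 1 / (x + (n + 1)) :=
  sum_range_succ _ _

lemma genH2_succ (n : ℕ) (x : ℂ) : genH2 (n + 1) x = genH2 n x + 1 / (x + (n + 1)) ^ 2 :=
  sum_range_succ _ _

lemma genH_succ_sub_one (n : ℕ) (x : ℂ) : genH (n + 1) (x - 1) = genH n x + 1 / x := by
  rw [genH, sum_range_succ']
  congr 1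
  · exact sum_congr rfl fun k _ => by push_cast; ring_nf
  · simp

lemma cbinom_add_succ (z : ℂ) (n : ℕ) :
    cbinom (z + (n + 1 : ℕ)) (n + 1) = cbinom (z + n) n * ((z + n + 1) / (n + 1)) := by
  have h : (n.factorial : ℂ) ≠ 0 := by exact_mod_cast n.factorial_ne_zero
  have h' : (n : ℂ) + 1 ≠ 0 := by exact_mod_cast n.succ_ne_zero
  have hp : ∏ j ∈ range n, (z + (n + 1 : ℕ) - (j + 1 : ℕ)) = ∏ j ∈ range n, (z + n - j) :=
    prod_congr rfl fun j _ => by push_cast; ring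
  rw [cbinom, cbinom, prod_range_succ', hp, Nat.factorial_succ]
  push_cast
  field_simp
  ring

lemma cbinom_zero (z : ℂ) : cbinom z 0 = 1 := by simp [cbinom]

section NonInteger

variable {x : ℂ}

lemma add_natCast_ne_zero (hx : ∀ m : ℤ, x ≠ m) (n : ℕ) : x + n ≠ 0 := fun h =>
  hx (-n) (by push_cast; linear_combination h)

lemma sub_natCast_ne_zero (hx : ∀ m : ℤ, x ≠ m) (n : ℕ) : x - n ≠ 0 := fun h =>
  hx n (by push_cast; linear_combination h)

lemma add_natCast_add_one_ne_zero (hx : ∀ m : ℤ, x ≠ m) (n : ℕ) : x + n + 1 ≠ 0 := by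
  have := add_natCast_ne_zero hx (n + 1)
  push_cast at this
  rwa [add_assoc]

lemma sub_natCast_sub_one_ne_zero (hx : ∀ m : ℤ, x ≠ m) (n : ℕ) : x - n - 1 ≠ 0 := by
  have := sub_natCast_ne_zero hx (n + 1)
  push_cast at this
  rwa [sub_sub]

lemma cbinom_add_ne_zero (hx : ∀ m : ℤ, x ≠ m) (n : ℕ) : cbinom (x + n) n ≠ 0 := by
  induction n with
  | zero => simp [cbinom_zero]
  | succ n ih =>
    rw [cbinom_add_succ]
    exact mul_ne_zero ih (div_ne_zero (add_natCast_add_one_ne_zero hx n)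
      (by exact_mod_cast n.succ_ne_zero))

lemma legendreTerm_zero (n : ℕ) : legendreTerm x n 0 = 1 := by simp [legendreTerm, cbinom_zero]

lemma legendreTerm_of_lt {n k : ℕ} (h : n < k) : legendreTerm x n k = 0 := by
  simp [legendreTerm, Nat.choose_eq_zero_of_lt h]

lemma legendreTerm_succ_right (hx : ∀ m : ℤ, x ≠ m) (n k : ℕ) :
    (k + 1) * (x + k + 1) * legendreTerm x n (k + 1)
      = -((n - k) * (n + k + 1) * legendreTerm x n k) := by
  have hk : (k : ℂ) + 1 ≠ 0 := by exact_mod_cast k.succ_ne_zero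
  have hb := cbinom_add_ne_zero hx k
  have hxk := add_natCast_add_one_ne_zero hx k
  have h₁ : (n.choose (k + 1) : ℂ) * (k + 1) = n.choose k * (n - k) := by
    rcases le_or_gt k n with h | h
    · have := Nat.choose_succ_right_eq n k
      rw [← Nat.cast_sub h]
      exact_mod_cast this
    · simp [Nat.choose_eq_zero_of_lt h, Nat.choose_eq_zero_of_lt (h.trans k.lt_succ_self)]
  have h₂ : ((n + (k + 1)).choose (k + 1) : ℂ) * (k + 1) = (n + k + 1) * (n + k).choose k := by
    exact_mod_cast (Nat.add_one_mul_choose_eq (n + k) k).symm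
  rw [legendreTerm, legendreTerm, cbinom_add_succ]
  field_simp
  rw [pow_succ]
  linear_combination (-1 : ℂ) ^ k * (-(n + (k + 1)).choose (k + 1) * (k + 1) * h₁
    - n.choose k * (n - k) * h₂)

lemma legendreTerm_succ_left (n k : ℕ) :
    (n + 1 - k) * legendreTerm x (n + 1) k = (n + 1 + k) * legendreTerm x n k := by
  have h₁ : ((n + 1).choose k : ℂ) * (n + 1 - k) = (n + 1) * n.choose k := by
    rcases le_or_gt k (n + 1) with h | h
    · have := Nat.choose_mul_succ_eq n k
      have hc : ((n + 1 - k : ℕ) : ℂ) = n + 1 - k := by push_cast [Nat.cast_sub h]; ring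
      rw [← hc, mul_comm ((n : ℂ) + 1)]
      exact_mod_cast this.symm
    · simp [Nat.choose_eq_zero_of_lt h, Nat.choose_eq_zero_of_lt (n.lt_succ_self.trans h)]
  have h₂ : ((n + 1 + k).choose k : ℂ) * (n + 1) = (n + 1 + k) * (n + k).choose k := by
    have := Nat.choose_mul_succ_eq (n + k) k
    rw [show n + k + 1 - k = n + 1 by omega, show n + k + 1 = n + 1 + k by omega] at this
    rw [mul_comm ((n : ℂ) + 1 + k)]
    exact_mod_cast this.symm
  rw [legendreTerm, legendreTerm]
  linear_combination (-1 : ℂ) ^ k / cbinom (x + k) k * ((n + 1 + k).choose k * h₁ + n.choose k * h₂)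

lemma reflectionRatio_succ (hx : ∀ m : ℤ, x ≠ m) (n : ℕ) :
    (x + n + 1) * reflectionRatio x (n + 1) = (x - n - 1) * reflectionRatio x n := by
  have hn : (n : ℂ) + 1 ≠ 0 := by exact_mod_cast n.succ_ne_zero
  have hb := cbinom_add_ne_zero hx n
  have hxn := add_natCast_add_one_ne_zero hx n
  rw [reflectionRatio, reflectionRatio, cbinom_add_succ, cbinom_add_succ]
  field_simp
  ring

lemma genH_half_add_succ (hx : ∀ m : ℤ, x ≠ m) (n : ℕ) :
    genH (n + 2) ((x - (n + 1 : ℕ) - 2) / 2) + genH (n + 1) ((x - n - 2) / 2)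
      = 2 * (genH (n + 1) x - genH (n + 1) (-x) + 1 / x) := by
  have step (m : ℕ) : genH (m + 3) ((x - (m + 2 : ℕ) - 2) / 2)
      = genH (m + 1) ((x - m - 2) / 2) + 2 / (x + m + 2) + 2 / (x - m - 2) := by
    have h₁ : x + m + 2 ≠ 0 := by
      have := add_natCast_ne_zero hx (m + 2); push_cast at this; rwa [add_assoc]
    have h₂ : x - m - 2 ≠ 0 := by
      have := sub_natCast_ne_zero hx (m + 2); push_cast at this; rwa [sub_sub]
    rw [show (x - (m + 2 : ℕ) - 2) / 2 = (x - m - 2) / 2 - 1 by push_cast; ring,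
      genH_succ_sub_one, genH_succ,
      show (x - m - 2) / 2 + ((m + 1 : ℕ) + 1) = (x + m + 2) / 2 by push_cast; ring]
    field_simp
  have hx0 : x ≠ 0 := by simpa using hx 0
  induction n with
  | zero =>
    have h₁ := add_natCast_add_one_ne_zero hx 0
    have h₂ := sub_natCast_sub_one_ne_zero hx 0
    simp only [Nat.cast_zero, add_zero, sub_zero] at h₁ h₂
    have e₁ : (x - 1 - 2) / 2 + 1 = (x - 1) / 2 := by ring
    have e₂ : (x - 1 - 2) / 2 + (1 + 1) = (x + 1) / 2 := by ring
    have e₃ : (x - 2) / 2 + 1 = x / 2 := by ring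
    have e₄ : -x + 1 = -(x - 1) := by ring
    simp [genH, sum_range_succ, e₁, e₂, e₃, e₄, -neg_sub]
    field_simp
    ring
  | succ n ih =>
    have e : -x + ((n + 1 : ℕ) + 1) = -(x - n - 2) := by push_cast; ring
    rw [step, genH_succ (n + 1) x, genH_succ (n + 1) (-x), e, div_neg]
    push_cast at ih ⊢
    rw [show x + ((n : ℂ) + 1 + 1) = x + n + 2 by ring]
    linear_combination ih

lemma altH_succ (hx : ∀ m : ℤ, x ≠ m) (n : ℕ) :
    altH x (n + 1) = 1 / (x + n + 1) + 1 / (x - n - 1) - altH x n := by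
  have h := genH_half_add_succ hx n
  have e : -x + ((n : ℂ) + 1) = -(x - n - 1) := by ring
  rw [genH_succ n x, genH_succ n (-x), e, div_neg, ← add_assoc] at h
  rw [altH, altH, genH_succ n x, genH_succ n (-x), e, div_neg, ← add_assoc]
  linear_combination h

lemma altH_zero : altH x 0 = 1 / x := by
  have e : (x - 2) / 2 + 1 = x / 2 := by ring
  simp [altH, genH, e]
  ring

/-- Summing past the last nonzero term changes nothing. -/
lemma sum_legendreTerm_mul_extend (n : ℕ) (f : ℕ → ℂ) :
    ∑ k ∈ range (n + 2), legendreTerm x n k * f k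
      = ∑ k ∈ range (n + 1), legendreTerm x n k * f k := by
  rw [sum_range_succ, legendreTerm_of_lt n.lt_succ_self, zero_mul, add_zero]

lemma legendreTerm_telescope (hx : ∀ m : ℤ, x ≠ m) (n k : ℕ) :
    (x + n + 1) * legendreTerm x (n + 1) k - (x - n - 1) * legendreTerm x n k
      = (x + k) * (legendreTerm x (n + 1) k - legendreTerm x n k)
        - (x + k + 1) * (legendreTerm x (n + 1) (k + 1) - legendreTerm x n (k + 1)) := by
  have hk : (k : ℂ) + 1 ≠ 0 := by exact_mod_cast k.succ_ne_zero
  have h₁ := legendreTerm_succ_right hx n k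
  have h₂ := legendreTerm_succ_right hx (n + 1) k
  have h₃ := legendreTerm_succ_left (x := x) n k
  push_cast at h₂
  apply mul_left_cancel₀ hk
  linear_combination h₂ - h₁ - (n + 1) * h₃

/-- The Chu–Vandermonde evaluation. -/
lemma sum_legendreTerm (hx : ∀ m : ℤ, x ≠ m) (n : ℕ) :
    ∑ k ∈ range (n + 1), legendreTerm x n k = reflectionRatio x n := by
  induction n with
  | zero => simp [legendreTerm_zero, reflectionRatio, cbinom_zero]
  | succ n ih =>
    have key (N : ℕ) : ∑ k ∈ range N,
        ((x + n + 1) * legendreTerm x (n + 1) k - (x - n - 1) * legendreTerm x n k)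
          = -((x + N) * (legendreTerm x (n + 1) N - legendreTerm x n N)) := by
      induction N with
      | zero => simp [legendreTerm_zero]
      | succ N ihN =>
        rw [sum_range_succ, ihN, legendreTerm_telescope hx]
        push_cast
        ring
    have h := key (n + 2)
    have hext := sum_legendreTerm_mul_extend (x := x) n fun _ => 1
    simp only [mul_one] at hext
    rw [legendreTerm_of_lt (by omega), legendreTerm_of_lt (by omega), sum_sub_distrib,
      ← mul_sum, ← mul_sum, hext, ih] at h
    apply mul_left_cancel₀ (add_natCast_add_one_ne_zero hx n)
    rw [reflectionRatio_succ hx]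
    linear_combination h

lemma sum_legendreTerm_div (hx : ∀ m : ℤ, x ≠ m) (n : ℕ) :
    ∑ k ∈ range (n + 1), legendreTerm x n k * (1 / (x + k)) = reflectionRatio x n * altH x n := by
  induction n with
  | zero => simp [legendreTerm_zero, reflectionRatio, cbinom_zero, altH_zero]
  | succ n ih =>
    have h₁ := add_natCast_add_one_ne_zero hx n
    have h₂ := sub_natCast_sub_one_ne_zero hx n
    have key : ∑ k ∈ range (n + 2), ((x + n + 1) * (legendreTerm x (n + 1) k * (1 / (x + k)))
          + (x - n - 1) * (legendreTerm x n k * (1 / (x + k))))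
        = ∑ k ∈ range (n + 2), (legendreTerm x (n + 1) k + legendreTerm x n k * 1) := by
      refine sum_congr rfl fun k _ => ?_
      have hk := add_natCast_ne_zero hx k
      field_simp
      linear_combination legendreTerm_succ_left (x := x) n k
    rw [sum_add_distrib, sum_add_distrib, ← mul_sum, ← mul_sum, sum_legendreTerm_mul_extend,
      sum_legendreTerm_mul_extend, ih, sum_legendreTerm hx (n + 1)] at key
    simp only [mul_one] at key
    rw [sum_legendreTerm hx n] at key
    have hr := reflectionRatio_succ hx n
    have hr' : reflectionRatio x (n + 1) = (x - n - 1) * reflectionRatio x n / (x + n + 1) := by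
      rw [← hr]; field_simp
    apply mul_left_cancel₀ h₁
    rw [altH_succ hx]
    rw [hr'] at key ⊢
    rw [eq_sub_of_add_eq key]
    field_simp

lemma sum_legendreTerm_mul_genH2 (hx : ∀ m : ℤ, x ≠ m) (n : ℕ) :
    ∑ k ∈ range (n + 1), legendreTerm x n k * genH2 k x
      = reflectionRatio x n *
        ((altH x n ^ 2 + (genH2 n x - genH2 n (-x)) - 1 / x ^ 2) / 2) := by
  induction n with
  | zero => simp [genH2, altH_zero]
  | succ n ih =>
    have h₁ := add_natCast_add_one_ne_zero hx n
    have h₂ := sub_natCast_sub_one_ne_zero hx n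
    have key (N : ℕ) : ∑ k ∈ range N, ((x + n + 1) * (legendreTerm x (n + 1) k * genH2 k x)
          - (x - n - 1) * (legendreTerm x n k * genH2 k x))
        = ∑ k ∈ range N, (legendreTerm x (n + 1) k * (1 / (x + k))
            - legendreTerm x n k * (1 / (x + k)))
          + (1 / (x + N) - (x + N) * genH2 N x)
            * (legendreTerm x (n + 1) N - legendreTerm x n N) := by
      induction N with
      | zero => simp [legendreTerm_zero]
      | succ N ihN =>
        have hN := add_natCast_ne_zero hx N
        have hN' := add_natCast_add_one_ne_zero hx N
        have ht := legendreTerm_telescope hx n N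
        rw [sum_range_succ, ihN, sum_range_succ, genH2_succ]
        push_cast
        rw [← add_assoc]
        have e : (x + N + 1) * (1 / (x + N + 1) ^ 2) = 1 / (x + N + 1) := by field_simp
        linear_combination genH2 N x * ht
          + (legendreTerm x (n + 1) (N + 1) - legendreTerm x n (N + 1)) * e
    have h := key (n + 2)
    rw [legendreTerm_of_lt (by omega), legendreTerm_of_lt (by omega), sum_sub_distrib,
      sum_sub_distrib, ← mul_sum, ← mul_sum, sum_legendreTerm_mul_extend,
      sum_legendreTerm_mul_extend, ih, sum_legendreTerm_div hx, sum_legendreTerm_div hx] at h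
    have hr := reflectionRatio_succ hx n
    have hr' : reflectionRatio x (n + 1) = (x - n - 1) * reflectionRatio x n / (x + n + 1) := by
      rw [← hr]; field_simp
    have e : -x + ((n : ℂ) + 1) = -(x - n - 1) := by ring
    apply mul_left_cancel₀ h₁
    rw [eq_add_of_sub_eq h, altH_succ hx, genH2_succ n x, genH2_succ n (-x), e, neg_sq, hr',
      ← add_assoc]
    have hx0 : x ≠ 0 := by simpa using hx 0
    field_simp
    ring

lemma sum_legendreTerm_mul_mul_genH2 (hx : ∀ m : ℤ, x ≠ m) (n : ℕ) :
    (1 - x) * ∑ k ∈ range (n + 1), legendreTerm x n k * k * genH2 k x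
      = n * (n + 1) * ∑ k ∈ range (n + 1), legendreTerm x n k * genH2 k x
        - ∑ k ∈ range (n + 1), legendreTerm x n k
        + x * ∑ k ∈ range (n + 1), legendreTerm x n k * (1 / (x + k)) := by
  have key (N : ℕ) : (1 - x) * ∑ k ∈ range N, legendreTerm x n k * k * genH2 k x
      = n * (n + 1) * ∑ k ∈ range N, legendreTerm x n k * genH2 k x
        - ∑ k ∈ range N, legendreTerm x n k
        + x * ∑ k ∈ range N, legendreTerm x n k * (1 / (x + k))
        + (N * (x + N) * genH2 N x - N / (x + N)) * legendreTerm x n N := by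
    induction N with
    | zero => simp
    | succ N ihN =>
      have hN := add_natCast_ne_zero hx N
      have hN' := add_natCast_add_one_ne_zero hx N
      have ht := legendreTerm_succ_right hx n N
      simp only [sum_range_succ, genH2_succ]
      push_cast
      rw [← add_assoc x (N : ℂ) 1]
      have e : (x + N + 1) * (1 / (x + N + 1) ^ 2) = 1 / (x + N + 1) := by field_simp
      have e' : x * (1 / (x + N)) = 1 - N / (x + N) := by field_simp; ring
      linear_combination ihN - genH2 N x * ht
        - (N + 1) * legendreTerm x n (N + 1) * e - legendreTerm x n N * e'
  have h := key (n + 1)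
  rwa [legendreTerm_of_lt n.lt_succ_self, mul_zero, add_zero] at h

end NonInteger

theorem stmt1 (n : ℕ) (hn : 0 < n) (x : ℂ) (hx : ∀ m : ℤ, x ≠ (m : ℂ)) :
    ∑ k ∈ Finset.range (n + 1),
      (-1 : ℂ) ^ k * (n.choose k : ℂ) * (((n + k).choose k : ℂ) / cbinom (x + k) k) *
        (k : ℂ) * genH2 k x
    = (-1 : ℂ) ^ n * ((n : ℂ) * (n + 1) / (2 * (1 - x))) *
      (cbinom (-x + n) n / cbinom (x + n) n) *
      (genH2 n x - genH2 n (-x)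
        + (genH n x - genH n (-x)) *
          (genH n x - genH n (-x) - 2 * genH (n + 1) ((x - n - 2) / 2)
            - 2 * (x ^ 2 - n - (n : ℂ) ^ 2) / (x * n * (n + 1)))
        + genH n ((x - n) / 2) *
          (genH (n + 1) ((x - n - 2) / 2)
            + 2 * (x ^ 3 - n * x ^ 2 + (n : ℂ) ^ 2 + (n : ℂ) ^ 3) / (x * (x - n) * n * (n + 1)))
        + 4 * (x ^ 2 - n * x + n + (n : ℂ) ^ 2) / (x * (x - n) ^ 2 * (n + 1))) := by
  have hx0 : x ≠ 0 := by simpa using hx 0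
  have hx1 : 1 - x ≠ 0 := fun h => hx 1 (by push_cast; linear_combination -h)
  have hn0 : (n : ℂ) ≠ 0 := by exact_mod_cast hn.ne'
  have hn1 : (n : ℂ) + 1 ≠ 0 := by exact_mod_cast n.succ_ne_zero
  have hxn := sub_natCast_ne_zero hx n
  have hA : genH n ((x - n) / 2) = genH (n + 1) ((x - n - 2) / 2) - 2 / (x - n) := by
    rw [show (x - n - 2) / 2 = (x - n) / 2 - 1 by ring, genH_succ_sub_one]
    field_simp
    ring
  have h := sum_legendreTerm_mul_mul_genH2 hx n
  rw [sum_legendreTerm_mul_genH2 hx, sum_legendreTerm hx, sum_legendreTerm_div hx,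
    altH, reflectionRatio] at h
  simp only [legendreTerm] at h
  apply mul_left_cancel₀ hx1
  rw [h, hA]
  generalize genH (n + 1) ((x - n - 2) / 2) = A
  generalize genH n x - genH n (-x) = D
  generalize genH2 n x - genH2 n (-x) = Q
  generalize cbinom (-x + n) n / cbinom (x + n) n = c
  field_simp
  ring
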